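/- Let n ≥ 2, let λ be the smallest nonzero eigenvalue of H_{W,0}, and let Γ satisfy Γλ + 1 > 5n. Fix i ≠ j in {1,…,n} and define C := (1/n)·(2 + Σ_{a≠i}Σ_{b≠j} ⟨e_a⊕e_i| G |e_b⊕e_j⟩ + Σ_{a≠j}Σ_{b≠i} ⟨e_a⊕e_j| G |e_b⊕e_i⟩), where |e_a⊕e_i⟩ is the computational basis state with 1s exactly in positions a and i. Then C is real and C ≥ 1/n. -/

import Mathlib

open Matrix
open scoped Kronecker ComplexOrder

namespace QSim

/-- Index set for the computational basis of `n` qubits. -/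
abbrev QIdx (n : ℕ) := Fin n → Fin 2

/-- Operators (matrices) on the Hilbert space of `n` qubits. -/
abbrev QOp (n : ℕ) := Matrix (QIdx n) (QIdx n) ℂ

/-- The operator (`ℓ²→ℓ²`) norm of a (possibly rectangular) matrix. -/
noncomputable def opNorm {I J : Type*} [Fintype I] [Fintype J] [DecidableEq J]
    (M : Matrix I J ℂ) : ℝ :=
  ‖LinearMap.toContinuousLinearMap (Matrix.toEuclideanLin M)‖

/-- A two-qubit operator `E` placed on qubits `i` and `j` of an `n`-qubit register
(identity elsewhere), given entrywise. -/
def twoQubitOp (n : ℕ) (i j : Fin n) (E : Fin 2 → Fin 2 → Fin 2 → Fin 2 → ℂ) : QOp n :=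
  fun x y => E (x i) (x j) (y i) (y j) * (if ∀ k, k ≠ i → k ≠ j → x k = y k then 1 else 0)

/-- A single-qubit operator `E` placed on qubit `i` of an `n`-qubit register. -/
def oneQubitOp (n : ℕ) (i : Fin n) (E : Matrix (Fin 2) (Fin 2) ℂ) : QOp n :=
  fun x y => E (x i) (y i) * (if ∀ k, k ≠ i → x k = y k then 1 else 0)

/-- Sign used to build `(|01⟩ - |10⟩)/√2`. -/
def sgnE (a b : Fin 2) : ℂ :=
  if a = 0 ∧ b = 1 then 1 else if a = 1 ∧ b = 0 then -1 else 0

/-- Entries of the two-qubit projector `P` onto `span{(|01⟩-|10⟩)/√2, |11⟩}`: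
`P = (1/2)(|01⟩-|10⟩)(⟨01|-⟨10|) + |11⟩⟨11|`. -/
noncomputable def Pentry (a b c d : Fin 2) : ℂ :=
  (1 / 2) * sgnE a b * sgnE c d + (if a = 1 ∧ b = 1 ∧ c = 1 ∧ d = 1 then 1 else 0)

/-- `H_{W,0} = Σ_{i=1}^{n-1} P_{i,i+1}`. -/
noncomputable def HW0 (n : ℕ) : QOp n :=
  ∑ i : Fin (n - 1),
    twoQubitOp n ⟨i.1, by have := i.2; omega⟩ ⟨i.1 + 1, by have := i.2; omega⟩ Pentry

/-- The all-zeros state `|0…0⟩`. -/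
def ket0 (n : ℕ) : QIdx n → ℂ := fun x => if ∀ k, x k = 0 then 1 else 0

/-- The generalized W state `|W_n⟩ = n^{-1/2} Σ_i |e_i⟩`. -/
noncomputable def Wstate (n : ℕ) : QIdx n → ℂ := fun x =>
  if (Finset.univ.filter fun k => x k = 1).card = 1 then (((Real.sqrt n)⁻¹ : ℝ) : ℂ) else 0

end QSim

namespace QSim

/-- The Pauli `Z` matrix. -/
noncomputable def Zmat : Matrix (Fin 2) (Fin 2) ℂ := !![1, 0; 0, -1]

/-- The Pauli `X` matrix. -/
noncomputable def Xmat : Matrix (Fin 2) (Fin 2) ℂ := !![0, 1; 1, 0]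

/-- The W-state parent Hamiltonian `H_W = Γ·H_{W,0} + 1 - Σ_{i=1}^n (1 - Z_i)/2`. -/
noncomputable def HWham (n : ℕ) (Γ : ℝ) : QOp n :=
  (Γ : ℂ) • HW0 n + 1 - ∑ i : Fin n, oneQubitOp n i ((1 - Zmat) / 2)

end QSim

namespace QSim

/-- The rank-one projector `Π₋ = |W_n⟩⟨W_n|` (entries are real, so no conjugation is needed). -/
noncomputable def projW (n : ℕ) : QOp n := fun x y => Wstate n x * Wstate n y

/-- The Pauli `X` operator on qubit `i` of the chain. -/
noncomputable def Xop (n : ℕ) (i : Fin n) : QOp n := oneQubitOp n i Xmat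

/-- The computational basis index with `1`s exactly in positions `a` and `i` (for `a ≠ i`),
i.e. the label of the basis state `|e_a ⊕ e_i⟩`. -/
def pairIdx (n : ℕ) (a i : Fin n) : QIdx n := fun k => if k = a ∨ k = i then 1 else 0

/-- The expectation value `⟨W_n| M |W_n⟩`. -/
noncomputable def expectW (n : ℕ) (M : QOp n) : ℂ :=
  star (Wstate n) ⬝ᵥ (M *ᵥ Wstate n)

end QSim

namespace QSim

/-- A Hermitian matrix whose nonzero eigenvalues are at least `lam` is bounded below by `lam` on
vectors orthogonal to its kernel. -/
lemma _root_.Matrix.IsHermitian.mul_dotProduct_le_of_orthogonal_ker {ι : Type*} [Fintype ι]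
    [DecidableEq ι] {A : Matrix ι ι ℂ} (hA : A.IsHermitian) {lam : ℝ}
    (hmin : ∀ μ : ℝ, (μ : ℂ) ∈ spectrum ℂ A → μ ≠ 0 → lam ≤ μ) {w : ι → ℂ}
    (hw : ∀ v, A *ᵥ v = 0 → star v ⬝ᵥ w = 0) :
    lam * (star w ⬝ᵥ w).re ≤ (star w ⬝ᵥ (A *ᵥ w)).re := by
  set e := hA.eigenvectorBasis with he
  have key : ∀ x : ι → ℂ, star w ⬝ᵥ x =
      ∑ k, (star w ⬝ᵥ (e k).ofLp) * (star (e k).ofLp ⬝ᵥ x) := by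
    intro x
    have := e.sum_inner_mul_inner (WithLp.toLp 2 w) (WithLp.toLp 2 x)
    simpa [EuclideanSpace.inner_eq_star_dotProduct, dotProduct_comm] using this.symm
  have hconj : ∀ k, star w ⬝ᵥ (e k).ofLp = star (star (e k).ofLp ⬝ᵥ w) := by
    intro k
    rw [← star_dotProduct_star, star_star]
  have hAe : ∀ k, star (e k).ofLp ⬝ᵥ (A *ᵥ w) =
      (hA.eigenvalues k : ℂ) * (star (e k).ofLp ⬝ᵥ w) := by
    intro k
    have h1 : star (A *ᵥ (e k).ofLp) = (hA.eigenvalues k : ℂ) • star (e k).ofLp := by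
      rw [he, hA.mulVec_eigenvectorBasis]
      ext x
      simp
    rw [dotProduct_mulVec, ← smul_eq_mul, ← smul_dotProduct, ← h1, star_mulVec, hA.eq]
  rw [key w, key (A *ᵥ w), Complex.re_sum, Complex.re_sum, Finset.mul_sum]
  refine Finset.sum_le_sum fun k _ => ?_
  rw [hAe k, hconj k]
  set z := star (e k).ofLp ⬝ᵥ w with hz
  have h2 : star z * ((hA.eigenvalues k : ℂ) * z) =
      ((hA.eigenvalues k * Complex.normSq z : ℝ) : ℂ) := by
    push_cast
    rw [← Complex.mul_conj, starRingEnd_apply]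
    ring
  have h3 : star z * z = ((Complex.normSq z : ℝ) : ℂ) := by
    rw [← Complex.mul_conj, starRingEnd_apply, mul_comm]
  rw [h2, h3, Complex.ofReal_re, Complex.ofReal_re]
  by_cases h0 : hA.eigenvalues k = 0
  · have : z = 0 := by
      refine hw _ ?_
      rw [he, hA.mulVec_eigenvectorBasis, h0, zero_smul]
    simp [this]
  · refine mul_le_mul_of_nonneg_right (hmin _ ?_ h0) (Complex.normSq_nonneg z)
    rw [hA.spectrum_eq_image_range]
    exact ⟨_, ⟨k, rfl⟩, rfl⟩

/-- The Hamming weight of a computational basis label. -/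
def weight {n : ℕ} (x : QIdx n) : ℕ := (Finset.univ.filter fun k => x k = 1).card

lemma weight_comp_equiv {n : ℕ} (σ : Equiv.Perm (Fin n)) (x : QIdx n) :
    weight (x ∘ σ) = weight x := by
  unfold weight
  refine Finset.card_equiv σ fun k => ?_
  simp

lemma twoQubitOp_Pentry_apply (n : ℕ) (i j : Fin n) (x y : QIdx n) :
    twoQubitOp n i j Pentry x y =
      (1 / 2) * ((if x = y then 1 else 0) - (if x ∘ Equiv.swap i j = y then 1 else 0)) +
        if x = y then (if x i = 1 ∧ x j = 1 then 1 else 0) else 0 := by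
  have h1 : x = y ↔ (x i = y i ∧ x j = y j) ∧ ∀ k, k ≠ i → k ≠ j → x k = y k := by
    constructor
    · rintro rfl
      simp
    · rintro ⟨⟨hi, hj⟩, h⟩
      funext k
      by_cases h1 : k = i
      · rw [h1, hi]
      by_cases h2 : k = j
      · rw [h2, hj]
      exact h k h1 h2
  have h2 : x ∘ Equiv.swap i j = y ↔
      (x j = y i ∧ x i = y j) ∧ ∀ k, k ≠ i → k ≠ j → x k = y k := by
    constructor
    · rintro rfl
      refine ⟨by simp, fun k hi hj => ?_⟩
      simp [Equiv.swap_apply_of_ne_of_ne hi hj]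
    · rintro ⟨⟨hi, hj⟩, h⟩
      funext k
      by_cases h1 : k = i
      · simp [h1, hi]
      by_cases h2 : k = j
      · simp [h2, hj]
      simp [Equiv.swap_apply_of_ne_of_ne h1 h2, h k h1 h2]
  simp only [twoQubitOp, h1, h2]
  by_cases h : ∀ k, k ≠ i → k ≠ j → x k = y k
  · simp only [iff_true_intro h, and_true]
    generalize x i = a
    generalize x j = b
    generalize y i = c
    generalize y j = d
    fin_cases a <;> fin_cases b <;> fin_cases c <;> fin_cases d <;>
      simp [Pentry, sgnE]
  · simp [h]

lemma twoQubitOp_Pentry_mulVec (n : ℕ) (i j : Fin n) (v : QIdx n → ℂ)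
    (x : QIdx n) :
    (twoQubitOp n i j Pentry *ᵥ v) x =
      (1 / 2) * (v x - v (x ∘ Equiv.swap i j)) + if x i = 1 ∧ x j = 1 then v x else 0 := by
  simp only [mulVec, dotProduct, twoQubitOp_Pentry_apply n i j, add_mul, mul_assoc, sub_mul,
    Finset.sum_add_distrib, ← Finset.mul_sum, Finset.sum_sub_distrib, ite_mul, one_mul, zero_mul,
    Finset.sum_ite_eq, Finset.mem_univ, if_true]

lemma isHermitian_twoQubitOp_Pentry (n : ℕ) (i j : Fin n) :
    (twoQubitOp n i j Pentry).IsHermitian := by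
  ext x y
  have hs : ∀ a b, star (sgnE a b) = sgnE a b := by
    intro a b
    unfold sgnE
    split_ifs <;> simp
  simp only [conjTranspose_apply, twoQubitOp, Pentry, star_mul', star_add, hs]
  have h1 : (∀ k, k ≠ i → k ≠ j → y k = x k) ↔ ∀ k, k ≠ i → k ≠ j → x k = y k := by
    simp only [eq_comm]
  simp only [h1]
  congr 1
  · congr 1
    · simp
      ring
    · have : (y i = 1 ∧ y j = 1 ∧ x i = 1 ∧ x j = 1) ↔
        (x i = 1 ∧ x j = 1 ∧ y i = 1 ∧ y j = 1) := by tauto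
      simp only [this]
      split_ifs <;> simp
  · split_ifs <;> simp

/-- The quadratic form of the projector `P` on qubits `i`, `j`, as a sum of squares. -/
lemma re_dotProduct_twoQubitOp_Pentry (n : ℕ) (i j : Fin n) (v : QIdx n → ℂ) :
    (star v ⬝ᵥ (twoQubitOp n i j Pentry *ᵥ v)).re =
      ∑ x, ((1 / 4) * Complex.normSq (v x - v (x ∘ Equiv.swap i j)) +
        if x i = 1 ∧ x j = 1 then Complex.normSq (v x) else 0) := by
  set σ : Equiv.Perm (QIdx n) := (Equiv.swap i j).arrowCongr (Equiv.refl _) with hσ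
  have hσx : ∀ x, σ x = x ∘ Equiv.swap i j := fun x => by
    funext k
    simp [hσ, Equiv.arrowCongr]
  have hσσ : ∀ x, σ (σ x) = x := fun x => by
    funext k
    simp [hσx]
  have hsym : ∑ x, (star (v x) * (v x - v (σ x))).re =
      ∑ x, (star (v (σ x)) * (v (σ x) - v x)).re := by
    rw [← Equiv.sum_comp σ]
    simp only [hσσ]
  have hsq : ∑ x, (star (v x) * (v x - v (σ x))).re =
      ∑ x, (1 / 2) * Complex.normSq (v x - v (σ x)) := by
    have : ∑ x, (star (v x) * (v x - v (σ x))).re +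
        ∑ x, (star (v (σ x)) * (v (σ x) - v x)).re =
        ∑ x, Complex.normSq (v x - v (σ x)) := by
      rw [← Finset.sum_add_distrib]
      refine Finset.sum_congr rfl fun x _ => ?_
      simp [Complex.normSq_apply]
      ring
    rw [← Finset.mul_sum]
    linarith
  simp only [← hσx, dotProduct, twoQubitOp_Pentry_mulVec n i j, Pi.star_apply, Complex.re_sum]
  have hx : ∀ x, (star (v x) * ((1 / 2) * (v x - v (σ x)) +
      if x i = 1 ∧ x j = 1 then v x else 0)).re =
      (1 / 2) * (star (v x) * (v x - v (σ x))).re +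
        if x i = 1 ∧ x j = 1 then Complex.normSq (v x) else 0 := by
    intro x
    split_ifs
    · simp [Complex.normSq_apply]
      ring
    · simp
      ring
  simp only [hx, Finset.sum_add_distrib]
  rw [← Finset.mul_sum, hsq, ← Finset.mul_sum, ← Finset.mul_sum]
  ring

lemma isHermitian_HW0 (n : ℕ) : (HW0 n).IsHermitian := by
  unfold HW0 Matrix.IsHermitian
  rw [conjTranspose_sum]
  exact Finset.sum_congr rfl fun k _ => isHermitian_twoQubitOp_Pentry n _ _

/-- A vector in the kernel of `H_{W,0}` vanishes on all labels with two or more `1`s. -/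
lemma apply_eq_zero_of_HW0_mulVec_eq_zero {n : ℕ} {v : QIdx n → ℂ} (hv : HW0 n *ᵥ v = 0)
    {x : QIdx n} {a b : Fin n} (hab : a < b) (ha : x a = 1) (hb : x b = 1) : v x = 0 := by
  have hloc : ∀ (k : ℕ) (h0 : k < n) (h1 : k + 1 < n) (y : QIdx n),
      v (y ∘ Equiv.swap ⟨k, h0⟩ ⟨k + 1, h1⟩) = v y ∧
        (y ⟨k, h0⟩ = 1 → y ⟨k + 1, h1⟩ = 1 → v y = 0) := by
    have hsum : (star v ⬝ᵥ (HW0 n *ᵥ v)).re = 0 := by simp [hv]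
    rw [HW0, sum_mulVec, dotProduct_sum, Complex.re_sum] at hsum
    simp only [re_dotProduct_twoQubitOp_Pentry] at hsum
    have hnn : ∀ (p q : Fin n) (y : QIdx n),
        0 ≤ (1 / 4) * Complex.normSq (v y - v (y ∘ Equiv.swap p q)) ∧
        0 ≤ if y p = 1 ∧ y q = 1 then Complex.normSq (v y) else 0 := by
      intro p q y
      refine ⟨mul_nonneg (by norm_num) (Complex.normSq_nonneg _), ?_⟩
      split_ifs
      · exact Complex.normSq_nonneg _
      · exact le_rfl
    rw [Finset.sum_eq_zero_iff_of_nonneg fun k _ =>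
      Finset.sum_nonneg fun y _ => add_nonneg (hnn _ _ _).1 (hnn _ _ _).2] at hsum
    intro k h0 h1 y
    have h := hsum ⟨k, by omega⟩ (Finset.mem_univ _)
    rw [Finset.sum_eq_zero_iff_of_nonneg fun y _ =>
      add_nonneg (hnn _ _ _).1 (hnn _ _ _).2] at h
    have h' := h y (Finset.mem_univ _)
    rw [add_eq_zero_iff_of_nonneg (hnn _ _ _).1 (hnn _ _ _).2] at h'
    obtain ⟨e1, e2⟩ := h'
    refine ⟨?_, fun p q => ?_⟩
    · have : Complex.normSq (v y - v (y ∘ Equiv.swap ⟨k, h0⟩ ⟨k + 1, h1⟩)) = 0 := by linarith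
      exact (sub_eq_zero.mp (Complex.normSq_eq_zero.mp this)).symm
    · rw [if_pos ⟨p, q⟩] at e2
      exact Complex.normSq_eq_zero.mp e2
  obtain ⟨a, han⟩ := a
  obtain ⟨b, hbn⟩ := b
  simp only [Fin.mk_lt_mk] at hab
  induction b, hab using Nat.le_induction generalizing x with
  | base => exact (hloc a han hbn x).2 ha hb
  | succ b hab ih =>
    have hbn' : b < n := by omega
    rw [← (hloc b hbn' hbn x).1]
    refine ih (x := x ∘ Equiv.swap ⟨b, hbn'⟩ ⟨b + 1, hbn⟩) ?_ hbn' ?_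
    · rw [Function.comp_apply, Equiv.swap_apply_of_ne_of_ne, ha] <;>
        simp only [ne_eq, Fin.mk.injEq] <;> omega
    · simpa using hb

lemma apply_eq_zero_of_weight_eq_two {n : ℕ} {v : QIdx n → ℂ} (hv : HW0 n *ᵥ v = 0)
    {x : QIdx n} (hx : weight x = 2) : v x = 0 := by
  obtain ⟨a, b, hab, hs⟩ := Finset.card_eq_two.mp hx
  have ha : x a = 1 := by
    have : a ∈ Finset.univ.filter fun k => x k = 1 := by simp [hs]
    simpa using this
  have hb : x b = 1 := by
    have : b ∈ Finset.univ.filter fun k => x k = 1 := by simp [hs]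
    simpa using this
  rcases lt_or_gt_of_ne hab with h | h
  · exact apply_eq_zero_of_HW0_mulVec_eq_zero hv h ha hb
  · exact apply_eq_zero_of_HW0_mulVec_eq_zero hv h hb ha

lemma one_sub_Zmat_div_two : (1 - Zmat) / 2 = (!![0, 0; 0, 1] : Matrix (Fin 2) (Fin 2) ℂ) := by
  have h : (2 : Matrix (Fin 2) (Fin 2) ℂ)⁻¹ = (1 / 2 : ℂ) • 1 := by
    refine Matrix.inv_eq_right_inv ?_
    rw [mul_smul_comm, mul_one]
    ext a b
    fin_cases a <;> fin_cases b <;> simp [Matrix.ofNat_apply]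
  rw [div_eq_mul_inv, h, mul_smul_comm, mul_one]
  ext a b
  fin_cases a <;> fin_cases b <;> norm_num [Zmat]

lemma number_mulVec (n : ℕ) (v : QIdx n → ℂ) (x : QIdx n) :
    ((∑ i : Fin n, oneQubitOp n i ((1 - Zmat) / 2)) *ᵥ v) x = weight x * v x := by
  have h : ∀ (i : Fin n) (y : QIdx n), oneQubitOp n i ((1 - Zmat) / 2) x y =
      if x = y then (if x i = 1 then 1 else 0) else 0 := by
    intro i y
    have h1 : x = y ↔ x i = y i ∧ ∀ k, k ≠ i → x k = y k := by
      constructor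
      · rintro rfl
        simp
      · rintro ⟨hi, h⟩
        funext k
        by_cases h1 : k = i
        · rw [h1, hi]
        exact h k h1
    rw [one_sub_Zmat_div_two]
    simp only [oneQubitOp, h1]
    by_cases h : ∀ k, k ≠ i → x k = y k
    · simp only [iff_true_intro h, and_true]
      generalize x i = a
      generalize y i = c
      fin_cases a <;> fin_cases c <;> simp
    · simp [h]
  rw [sum_mulVec, Finset.sum_apply]
  simp only [mulVec, dotProduct, h, ite_mul, one_mul, zero_mul, Finset.sum_ite_eq,
    Finset.mem_univ, if_true]
  rw [← Finset.sum_filter, Finset.sum_const, nsmul_eq_mul, weight]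

lemma HWham_mulVec (n : ℕ) (Γ : ℝ) (v : QIdx n → ℂ) (x : QIdx n) :
    (HWham n Γ *ᵥ v) x = Γ * (HW0 n *ᵥ v) x + (1 - weight x) * v x := by
  rw [HWham, sub_mulVec, add_mulVec, smul_mulVec, one_mulVec, Pi.sub_apply, number_mulVec]
  simp
  ring

/-- The component of a vector in the sector of Hamming weight two. -/
noncomputable def weightTwoPart {n : ℕ} (v : QIdx n → ℂ) : QIdx n → ℂ :=
  fun x => if weight x = 2 then v x else 0

lemma HW0_mulVec_weightTwoPart {n : ℕ} (v : QIdx n → ℂ) :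
    HW0 n *ᵥ weightTwoPart v = weightTwoPart (HW0 n *ᵥ v) := by
  funext x
  simp only [weightTwoPart, HW0, sum_mulVec, Finset.sum_apply,
    twoQubitOp_Pentry_mulVec, weight_comp_equiv]
  split_ifs <;> simp

lemma HWham_mulVec_weightTwoPart {n : ℕ} (Γ : ℝ) (v : QIdx n → ℂ) :
    HWham n Γ *ᵥ weightTwoPart v = weightTwoPart (HWham n Γ *ᵥ v) := by
  funext x
  rw [HWham_mulVec, HW0_mulVec_weightTwoPart]
  simp only [weightTwoPart, HWham_mulVec]
  split_ifs <;> simp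

lemma mul_dotProduct_weightTwoPart_le {n : ℕ} {lam : ℝ}
    (hmin : ∀ μ : ℝ, (μ : ℂ) ∈ spectrum ℂ (HW0 n) → μ ≠ 0 → lam ≤ μ) {Γ : ℝ} (hΓ : 0 ≤ Γ)
    (v : QIdx n → ℂ) :
    (Γ * lam - 1) * (star (weightTwoPart v) ⬝ᵥ weightTwoPart v).re ≤
      (star (weightTwoPart v) ⬝ᵥ (HWham n Γ *ᵥ weightTwoPart v)).re := by
  set w := weightTwoPart v with hw
  have hgap : lam * (star w ⬝ᵥ w).re ≤ (star w ⬝ᵥ (HW0 n *ᵥ w)).re := by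
    refine (isHermitian_HW0 n).mul_dotProduct_le_of_orthogonal_ker hmin fun u hu => ?_
    refine Finset.sum_eq_zero fun x _ => ?_
    by_cases hx : weight x = 2
    · simp [apply_eq_zero_of_weight_eq_two hu hx]
    · simp [hw, weightTwoPart, hx]
  have hH : HWham n Γ *ᵥ w = (Γ : ℂ) • (HW0 n *ᵥ w) - w := by
    funext x
    rw [HWham_mulVec]
    by_cases hx : weight x = 2
    · simp only [hx, Pi.sub_apply, Pi.smul_apply, smul_eq_mul]
      push_cast
      ring
    · simp [hw, weightTwoPart, hx]
  rw [hH, dotProduct_sub, dotProduct_smul, smul_eq_mul, Complex.sub_re, Complex.re_ofReal_mul]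
  nlinarith [mul_le_mul_of_nonneg_left hgap hΓ]

/-- The weight-two part `Σ_{a≠i} |e_a⊕e_i⟩` of `√n X_i |W_n⟩`. -/
noncomputable def pairState (n : ℕ) (i : Fin n) : QIdx n → ℂ :=
  ∑ a ∈ Finset.univ.erase i, Pi.single (pairIdx n a i) 1

lemma star_pairState (n : ℕ) (i : Fin n) : star (pairState n i) = pairState n i := by
  simp [pairState, Pi.star_single]

lemma pairState_dotProduct (n : ℕ) (i : Fin n) (v : QIdx n → ℂ) :
    pairState n i ⬝ᵥ v = ∑ a ∈ Finset.univ.erase i, v (pairIdx n a i) := by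
  simp [pairState, sum_dotProduct]

lemma weight_pairIdx {n : ℕ} {a i : Fin n} (h : a ≠ i) : weight (pairIdx n a i) = 2 := by
  have : (Finset.univ.filter fun k => pairIdx n a i k = 1) = {a, i} := by
    ext k
    simp [pairIdx, or_iff_not_imp_left]
  rw [weight, this, Finset.card_pair h]

lemma pairIdx_left_injOn {n : ℕ} {a b i : Fin n} (ha : a ≠ i)
    (h : pairIdx n a i = pairIdx n b i) : a = b := by
  have := congrFun h a
  by_contra hne
  simp [pairIdx, ha, hne] at this

lemma pairState_dotProduct_self (n : ℕ) (i : Fin n) :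
    pairState n i ⬝ᵥ pairState n i = ((n - 1 : ℝ) : ℂ) := by
  rw [pairState_dotProduct]
  have h : ∀ a ∈ Finset.univ.erase i, pairState n i (pairIdx n a i) = 1 := by
    intro a ha
    rw [pairState, Finset.sum_apply, Finset.sum_eq_single a]
    · simp
    · intro b _ hba
      rw [Pi.single_apply, if_neg]
      exact fun h => hba (pairIdx_left_injOn (Finset.ne_of_mem_erase ha) h).symm
    · exact fun h => absurd ha h
  rw [Finset.sum_congr rfl h]
  have hn : 1 ≤ n := i.pos
  simp [Finset.card_erase_of_mem, Nat.cast_sub hn]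

lemma weightTwoPart_pairState (n : ℕ) (i : Fin n) :
    weightTwoPart (pairState n i) = pairState n i := by
  funext x
  unfold weightTwoPart
  split_ifs with hx
  · rfl
  · symm
    rw [pairState, Finset.sum_apply]
    refine Finset.sum_eq_zero fun a ha => ?_
    rw [Pi.single_apply, if_neg]
    rintro rfl
    exact hx (weight_pairIdx (Finset.ne_of_mem_erase ha))

lemma pairState_dotProduct_weightTwoPart (n : ℕ) (i : Fin n) (v : QIdx n → ℂ) :
    pairState n i ⬝ᵥ weightTwoPart v = pairState n i ⬝ᵥ v := by
  rw [pairState_dotProduct, pairState_dotProduct]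
  refine Finset.sum_congr rfl fun a ha => ?_
  rw [weightTwoPart, if_pos (weight_pairIdx (Finset.ne_of_mem_erase ha))]

lemma weightTwoPart_projW_mulVec (n : ℕ) (v : QIdx n → ℂ) :
    weightTwoPart (projW n *ᵥ v) = 0 := by
  funext x
  unfold weightTwoPart
  split_ifs with hx
  · have : Wstate n x = 0 := by
      rw [Wstate, if_neg]
      rw [weight] at hx
      omega
    simp [mulVec, dotProduct, projW, this]
  · rfl

lemma re_dotProduct_pairState {n : ℕ} (i j : Fin n) (w : QIdx n → ℂ) {c : ℝ}
    (hc : 2 * ((n : ℝ) - 1) ≤ c) (hc0 : 0 < c)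
    (hw : c * (star w ⬝ᵥ w).re ≤ (star w ⬝ᵥ pairState n j).re) :
    -1 ≤ 2 * (pairState n i ⬝ᵥ w).re := by
  have hnn : ∀ z : QIdx n → ℂ, 0 ≤ (star z ⬝ᵥ z).re := fun z =>
    (Complex.le_def.mp (dotProduct_star_self_nonneg z)).1
  have hswap : ∀ k, (star w ⬝ᵥ pairState n k).re = (pairState n k ⬝ᵥ w).re := by
    intro k
    conv_lhs => rw [← star_pairState n k, star_dotProduct_star]
    simp
  have hexp : ∀ (k : Fin n) (s : ℝ), (star ((c : ℂ) • w + (s : ℂ) • pairState n k) ⬝ᵥ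
      ((c : ℂ) • w + (s : ℂ) • pairState n k)).re =
      c ^ 2 * (star w ⬝ᵥ w).re + 2 * c * s * (pairState n k ⬝ᵥ w).re + s ^ 2 * (n - 1) := by
    intro k s
    simp only [star_add, star_smul, star_pairState, add_dotProduct, dotProduct_add,
      smul_dotProduct, dotProduct_smul, pairState_dotProduct_self, smul_eq_mul,
      RCLike.star_def, Complex.conj_ofReal, Complex.add_re, Complex.re_ofReal_mul, hswap,
      Complex.ofReal_re]
    ring
  have h1 := hexp j (-1) ▸ hnn _
  have h2 := hexp i 1 ▸ hnn _
  rw [hswap] at hw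
  have h3 := mul_le_mul_of_nonneg_left hw hc0.le
  have h4 : 0 ≤ c * (2 * (pairState n i ⬝ᵥ w).re + 1) := by nlinarith
  have := nonneg_of_mul_nonneg_right h4 hc0
  linarith

/-- With `λ` the smallest nonzero eigenvalue of `H_{W,0}` and `Γλ + 1 > 5n`,
the coefficient
`C = (1/n)(2 + Σ_{a≠i}Σ_{b≠j}⟨e_a⊕e_i|G|e_b⊕e_j⟩ + Σ_{a≠j}Σ_{b≠i}⟨e_a⊕e_j|G|e_b⊕e_i⟩)`
is real and satisfies `C ≥ 1/n`. -/
theorem C_real_and_lower_bound (n : ℕ) (hn : 2 ≤ n) (lam : ℝ) (hlam_pos : 0 < lam)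
    (hlam_mem : (lam : ℂ) ∈ spectrum ℂ (HW0 n))
    (hlam_min : ∀ μ : ℝ, (μ : ℂ) ∈ spectrum ℂ (HW0 n) → μ ≠ 0 → lam ≤ μ)
    (Γ : ℝ) (hΓ : 5 * (n : ℝ) < Γ * lam + 1)
    (G : QOp n) (hG_herm : Gᴴ = G)
    (hG_left : G * HWham n Γ = 1 - projW n) (hG_right : HWham n Γ * G = 1 - projW n)
    (hG_W : G *ᵥ Wstate n = 0)
    (i j : Fin n) (hij : i ≠ j) :
    let C : ℂ := ((n : ℂ))⁻¹ *
      (2 + (∑ a ∈ Finset.univ.erase i, ∑ b ∈ Finset.univ.erase j,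
              G (pairIdx n a i) (pairIdx n b j))
         + (∑ a ∈ Finset.univ.erase j, ∑ b ∈ Finset.univ.erase i,
              G (pairIdx n a j) (pairIdx n b i)))
    C.im = 0 ∧ ((n : ℝ))⁻¹ ≤ C.re := by
  intro C
  have hn1 : (2 : ℝ) ≤ n := by exact_mod_cast hn
  have hΓ0 : 0 < Γ := by
    by_contra! h
    nlinarith [mul_nonneg (neg_nonneg.mpr h) hlam_pos.le]
  have hsum : ∀ p q : Fin n, ∑ a ∈ Finset.univ.erase p, ∑ b ∈ Finset.univ.erase q,
      G (pairIdx n a p) (pairIdx n b q) = pairState n p ⬝ᵥ (G *ᵥ pairState n q) := by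
    intro p q
    rw [pairState_dotProduct]
    refine Finset.sum_congr rfl fun a _ => ?_
    rw [mulVec, dotProduct_comm, pairState_dotProduct]
  have hconj : pairState n j ⬝ᵥ (G *ᵥ pairState n i) =
      star (pairState n i ⬝ᵥ (G *ᵥ pairState n j)) := by
    rw [← star_dotProduct_star, star_mulVec, star_pairState, star_pairState, hG_herm,
      ← dotProduct_mulVec]
  have hwH : HWham n Γ *ᵥ weightTwoPart (G *ᵥ pairState n j) = pairState n j := by
    have hpart : weightTwoPart (pairState n j - projW n *ᵥ pairState n j) =
        weightTwoPart (pairState n j) - weightTwoPart (projW n *ᵥ pairState n j) := by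
      funext x
      simp only [weightTwoPart, Pi.sub_apply]
      split_ifs <;> simp
    rw [HWham_mulVec_weightTwoPart, mulVec_mulVec, hG_right, sub_mulVec, one_mulVec, hpart,
      weightTwoPart_projW_mulVec, weightTwoPart_pairState, sub_zero]
  have hlow := mul_dotProduct_weightTwoPart_le hlam_min hΓ0.le (G *ᵥ pairState n j)
  rw [hwH] at hlow
  have hbound := re_dotProduct_pairState i j _ (by linarith) (by linarith) hlow
  rw [pairState_dotProduct_weightTwoPart] at hbound
  have hC : C = (((n : ℝ)⁻¹ * (2 + 2 * (pairState n i ⬝ᵥ (G *ᵥ pairState n j)).re) : ℝ) : ℂ) := by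
    simp only [C, hsum, hconj]
    rw [add_assoc, RCLike.star_def, Complex.add_conj]
    push_cast
    ring
  rw [hC, Complex.ofReal_im, Complex.ofReal_re]
  refine ⟨rfl, le_mul_of_one_le_right (by positivity) (by linarith)⟩

end QSim
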